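/- arXiv:1609.06090 — 2 statements merged into one kernel-verified Lean document; each statement's English description precedes it below -/
import Mathlib

section
/- For every real w > 0 and every complex s with Re(s) > r, one has ∑_{u_1,…,u_r ≥ 0} (a_1u_1+⋯+a_ru_r+w)^{−s} = (1/(D^s (r−1)!)) · ∑_{j_1=0}^{D/a_1−1} ⋯ ∑_{j_r=0}^{D/a_r−1} ∑_{k=0}^{r−1} [r,k] ∑_{j=0}^{k} (−1)^j C(k,j) ((a_1j_1+⋯+a_rj_r+w)/D)^j · ζ(s−k+j, (𝔯(j_1,…,j_r)+w)/D), where 𝔯(j_1,…,j_r) ∈ {0,1,…,D−1} is the remainder of a_1j_1+⋯+a_rj_r upon division by D. -/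
/-- Hurwitz zeta function as a series: `ζ(s,w) = ∑_{n≥0} (n+w)^{-s}`. -/
noncomputable def hurwitzZetaSeries (s w : ℂ) : ℂ := ∑' n : ℕ, ((n : ℂ) + w) ^ (-s)

theorem hasSum_sigma_of_summable_norm {β : Type*} {γ : β → Type*} {f : (Σ b, γ b) → ℂ}
    {g : β → ℂ} {a : ℂ} (hf : ∀ b, HasSum (fun c ↦ f ⟨b, c⟩) (g b))
    (hn : Summable fun b ↦ ∑' c, ‖f ⟨b, c⟩‖) (ha : HasSum g a) : HasSum f a := by
  refine ha.sigma_of_hasSum hf (Summable.of_norm ?_)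
  exact (summable_sigma_of_nonneg fun x ↦ norm_nonneg _).2 ⟨fun b ↦ (hf b).summable.norm, hn⟩

theorem card_piAntidiag_univ_fin (m n : ℕ) :
    (Finset.piAntidiag (Finset.univ : Finset (Fin (m + 1))) n).card = (n + m).choose m := by
  rw [← Finset.map_sym_eq_piAntidiag, Finset.card_map, Finset.sym_univ, Finset.card_univ,
    Sym.card_sym_eq_choose, Fintype.card_fin, show m + 1 + n - 1 = n + m by omega,
    Nat.choose_symm_add]

/-- Summing a function of `v 0 + ⋯ + v m` over `v`, grouped by the value of the sum. -/
theorem hasSum_comp_sum_of_hasSum_choose_mul {m : ℕ} {g : ℕ → ℂ} {a : ℂ}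
    (h : HasSum (fun n ↦ ((n + m).choose m : ℂ) * g n) a) :
    HasSum (fun v : Fin (m + 1) → ℕ ↦ g (∑ i, v i)) a := by
  rw [← (Equiv.sigmaFiberEquiv fun v : Fin (m + 1) → ℕ ↦ ∑ i, v i).hasSum_iff]
  have hset (n : ℕ) : {v : Fin (m + 1) → ℕ | ∑ i, v i = n} =
      (Finset.piAntidiag (Finset.univ : Finset (Fin (m + 1))) n : Finset _) := by
    ext v
    simp
  have hfin (n : ℕ) : Finite {v : Fin (m + 1) → ℕ // ∑ i, v i = n} :=
    Set.Finite.to_subtype (s := {v : Fin (m + 1) → ℕ | ∑ i, v i = n})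
      (hset n ▸ Finset.finite_toSet _)
  have hcard (n : ℕ) : Nat.card {v : Fin (m + 1) → ℕ // ∑ i, v i = n} = (n + m).choose m := by
    rw [← card_piAntidiag_univ_fin, ← Set.ncard_coe_finset, ← hset, Set.ncard]
    rfl
  have key (n : ℕ) (c : {v : Fin (m + 1) → ℕ // ∑ i, v i = n}) :
      ((fun v : Fin (m + 1) → ℕ ↦ g (∑ i, v i)) ∘
        (Equiv.sigmaFiberEquiv fun v : Fin (m + 1) → ℕ ↦ ∑ i, v i)) ⟨n, c⟩ = g n :=
    congrArg g c.2
  refine hasSum_sigma_of_summable_norm (fun n ↦ ?_) ?_ h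
  · have := Fintype.ofFinite {v : Fin (m + 1) → ℕ // ∑ i, v i = n}
    simp_rw [key]
    have hsum := hasSum_fintype fun _ : {v : Fin (m + 1) → ℕ // ∑ i, v i = n} ↦ g n
    rwa [Finset.sum_const, Finset.card_univ, ← Nat.card_eq_fintype_card, hcard,
      nsmul_eq_mul] at hsum
  · refine h.summable.norm.congr fun n ↦ ?_
    have := Fintype.ofFinite {v : Fin (m + 1) → ℕ // ∑ i, v i = n}
    simp_rw [key]
    simp [← hcard]

/-- Division with remainder in each coordinate. -/
def piDivModEquiv {ι : Type*} (M : ι → ℕ) (hM : ∀ i, 0 < M i) :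
    (Σ _ : (∀ i, Fin (M i)), ι → ℕ) ≃ (ι → ℕ) where
  toFun p i := p.1 i + M i * p.2 i
  invFun u := ⟨fun i ↦ ⟨u i % M i, Nat.mod_lt _ (hM i)⟩, fun i ↦ u i / M i⟩
  left_inv := by
    rintro ⟨j, v⟩
    refine Sigma.ext (funext fun i ↦ Fin.ext ?_) (heq_of_eq (funext fun i ↦ ?_))
    · simp [Nat.mod_eq_of_lt]
    · simp [Nat.add_mul_div_left _ _ (hM i), Nat.div_eq_of_lt]
  right_inv u := by
    ext i
    exact Nat.mod_add_div _ _

theorem natCast_add_ofReal_ne_zero (n : ℕ) {y : ℝ} (hy : 0 < y) : ((n : ℂ) + y) ≠ 0 := by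
  exact_mod_cast (by positivity : (n : ℝ) + y ≠ 0)

theorem hasSum_hurwitzZetaSeries {y : ℝ} (hy : 0 < y) {s : ℂ} (hs : 1 < s.re) :
    HasSum (fun n : ℕ ↦ ((n : ℂ) + (y : ℂ)) ^ (-s)) (hurwitzZetaSeries s y) := by
  refine Summable.hasSum (Summable.of_norm ?_)
  refine ((Real.summable_one_div_nat_add_rpow y s.re).2 hs).congr fun n ↦ ?_
  have hn : 0 < (n : ℝ) + y := by positivity
  rw [show (n : ℂ) + (y : ℂ) = ((n + y : ℝ) : ℂ) by push_cast; rfl,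
    Complex.norm_cpow_eq_rpow_re_of_pos hn, abs_of_pos hn, Complex.neg_re, Real.rpow_neg hn.le,
    one_div]

theorem sub_pow_mul_cpow {z : ℂ} (hz : z ≠ 0) (x s : ℂ) (k : ℕ) :
    ∑ l ∈ Finset.range (k + 1), (-1) ^ l * (k.choose l : ℂ) * x ^ l * z ^ (-(s - k + l)) =
      (z - x) ^ k * z ^ (-s) := by
  rw [sub_eq_neg_add z x, add_pow, Finset.sum_mul]
  refine Finset.sum_congr rfl fun l hl ↦ ?_
  have hl' : l ≤ k := Nat.lt_succ_iff.1 (Finset.mem_range.1 hl)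
  rw [show -(s - k + l) = ((k - l : ℕ) : ℂ) + -s by push_cast [hl']; ring,
    Complex.cpow_add _ _ hz, Complex.cpow_natCast, neg_pow]
  ring

theorem prod_range_natCast_add_succ (m n : ℕ) :
    ∏ i ∈ Finset.range m, ((n : ℂ) + (i + 1 : ℕ)) = (m.factorial : ℂ) * ((n + m).choose m : ℂ) := by
  rw [← Nat.cast_mul, ← Nat.ascFactorial_eq_factorial_mul_choose, Nat.ascFactorial_eq_prod_range]
  push_cast
  exact Finset.prod_congr rfl fun i _ ↦ by ring

/-- The weighted Hurwitz series at `y + q`, expressed through Hurwitz zeta values at `y`. The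
shift by `q ≤ m` is harmless because the weight vanishes at `-1, …, -m`. -/
theorem hasSum_choose_mul_cpow {m : ℕ} {c : ℕ → ℕ}
    (hc : ∀ x : ℂ, ∏ i ∈ Finset.range m, (x + (i + 1 : ℕ)) =
      ∑ k ∈ Finset.range (m + 1), (c k : ℂ) * x ^ k)
    {y : ℝ} (hy : 0 < y) {q : ℕ} (hq : q ≤ m) {x : ℂ} (hx : x = q + y) {s : ℂ}
    (hs : (m : ℝ) + 1 < s.re) :
    HasSum (fun n : ℕ ↦ ((n + m).choose m : ℂ) * ((n : ℂ) + x) ^ (-s))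
      (1 / (m.factorial : ℂ) * ∑ k ∈ Finset.range (m + 1), (c k : ℂ) *
        ∑ l ∈ Finset.range (k + 1), (-1) ^ l * (k.choose l : ℂ) * x ^ l *
          hurwitzZetaSeries (s - k + l) y) := by
  have hsum : HasSum (fun n : ℕ ↦ ∑ k ∈ Finset.range (m + 1), (c k : ℂ) *
        ∑ l ∈ Finset.range (k + 1), (-1) ^ l * (k.choose l : ℂ) * x ^ l *
          ((n : ℂ) + (y : ℂ)) ^ (-(s - k + l)))
      (∑ k ∈ Finset.range (m + 1), (c k : ℂ) *
        ∑ l ∈ Finset.range (k + 1), (-1) ^ l * (k.choose l : ℂ) * x ^ l *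
          hurwitzZetaSeries (s - k + l) y) := by
    refine hasSum_sum fun k hk ↦ (hasSum_sum fun l _ ↦ ?_).mul_left _
    refine (hasSum_hurwitzZetaSeries hy ?_).mul_left _
    have hk' : (k : ℝ) ≤ m := by
      exact_mod_cast Nat.lt_succ_iff.1 (Finset.mem_range.1 hk)
    have hl : (0 : ℝ) ≤ l := l.cast_nonneg
    simp only [Complex.add_re, Complex.sub_re, Complex.natCast_re]
    linarith
  have hterm (n : ℕ) : ∑ k ∈ Finset.range (m + 1), (c k : ℂ) *
        ∑ l ∈ Finset.range (k + 1), (-1) ^ l * (k.choose l : ℂ) * x ^ l *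
          ((n : ℂ) + (y : ℂ)) ^ (-(s - k + l)) =
      (∏ i ∈ Finset.range m, ((n : ℂ) - q + (i + 1 : ℕ))) * ((n : ℂ) + (y : ℂ)) ^ (-s) := by
    simp_rw [sub_pow_mul_cpow (natCast_add_ofReal_ne_zero n hy), hc, Finset.sum_mul, mul_assoc]
    rw [show (n : ℂ) + y - x = n - q by rw [hx]; ring]
  simp_rw [hterm] at hsum
  rw [← hasSum_nat_add_iff' q] at hsum
  have hzero : ∑ n ∈ Finset.range q, (∏ i ∈ Finset.range m, ((n : ℂ) - q + (i + 1 : ℕ))) *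
      ((n : ℂ) + (y : ℂ)) ^ (-s) = 0 := by
    refine Finset.sum_eq_zero fun n hn ↦ ?_
    have hnq := Finset.mem_range.1 hn
    rw [Finset.prod_eq_zero (i := q - n - 1) (Finset.mem_range.2 (by omega)), zero_mul]
    rw [show q - n - 1 + 1 = q - n by omega, Nat.cast_sub hnq.le]
    ring
  rw [hzero, sub_zero] at hsum
  refine (hsum.mul_left (1 / (m.factorial : ℂ))).congr_fun fun n ↦ ?_
  have hm : (m.factorial : ℂ) ≠ 0 := Nat.cast_ne_zero.2 m.factorial_ne_zero
  rw [Nat.cast_add, add_sub_cancel_right, prod_range_natCast_add_succ, hx, add_assoc]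
  field_simp

/-- Lemma 1.2: decomposition of the Barnes zeta function as a combination of
Hurwitz zeta values, taken at the remainders `𝔯(j₁,…,j_r)` of `a₁j₁+⋯+a_rj_r` modulo `D`. -/
theorem barnes_zeta_decomposition_remainder
    (r : ℕ) (hr : 1 ≤ r) (a : Fin r → ℕ) (ha : ∀ i, 0 < a i)
    (D : ℕ) (hD : 0 < D) (hdvd : ∀ i, a i ∣ D)
    (c : ℕ → ℕ)
    (hc : ∀ x : ℂ, ∏ i ∈ Finset.range (r - 1), (x + (i + 1 : ℕ)) =
      ∑ k ∈ Finset.range r, (c k : ℂ) * x ^ k)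
    (w : ℝ) (hw : 0 < w) (s : ℂ) (hs : (r : ℝ) < s.re) :
    (∑' u : Fin r → ℕ, (((∑ i, a i * u i : ℕ) : ℂ) + (w : ℂ)) ^ (-s)) =
      1 / ((D : ℂ) ^ s * (Nat.factorial (r - 1) : ℂ)) *
        ∑ j : ∀ i : Fin r, Fin (D / a i),
          ∑ k ∈ Finset.range r,
            (c k : ℂ) *
              ∑ l ∈ Finset.range (k + 1),
                (-1) ^ l * (k.choose l : ℂ) *
                  ((((∑ i, a i * (j i : ℕ) : ℕ) : ℂ) + (w : ℂ)) / (D : ℂ)) ^ l *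
                  hurwitzZetaSeries (s - (k : ℂ) + (l : ℂ))
                    ((((((∑ i, a i * (j i : ℕ)) % D : ℕ)) : ℂ) + (w : ℂ)) / (D : ℂ)) := by
  obtain ⟨m, rfl⟩ : ∃ m, r = m + 1 := ⟨r - 1, by omega⟩
  simp only [Nat.add_sub_cancel] at hc ⊢
  have hDR : (0 : ℝ) < D := Nat.cast_pos.2 hD
  have hDC : (D : ℂ) ≠ 0 := Nat.cast_ne_zero.2 hD.ne'
  have hM (i) : 0 < D / a i := Nat.div_pos (Nat.le_of_dvd hD (hdvd i)) (ha i)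
  refine HasSum.tsum_eq ?_
  rw [← (piDivModEquiv _ hM).hasSum_iff, Finset.mul_sum]
  have hfiber (j : ∀ i, Fin (D / a i)) := by
    have hlt : ∑ i, a i * (j i : ℕ) < D * (m + 1) := by
      calc ∑ i, a i * (j i : ℕ) < ∑ _i : Fin (m + 1), D :=
            Finset.sum_lt_sum_of_nonempty Finset.univ_nonempty fun i _ ↦ by
              calc a i * (j i : ℕ) < a i * (D / a i) :=
                    Nat.mul_lt_mul_of_pos_left (j i).2 (ha i)
                _ = D := Nat.mul_div_cancel' (hdvd i)
        _ = D * (m + 1) := by simp [mul_comm]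
    have hq : (∑ i, a i * (j i : ℕ)) / D ≤ m :=
      Nat.lt_succ_iff.1 (Nat.div_lt_of_lt_mul hlt)
    have hy : 0 < (((∑ i, a i * (j i : ℕ)) % D : ℕ) + w) / D := by positivity
    refine (hasSum_comp_sum_of_hasSum_choose_mul
      (hasSum_choose_mul_cpow hc hy hq (s := s)
        (x := (((∑ i, a i * (j i : ℕ) : ℕ) : ℂ) + w) / D) ?_ (by exact_mod_cast hs))).mul_left
      (1 / (D : ℂ) ^ s)
    conv_lhs => rw [← Nat.div_add_mod (∑ i, a i * (j i : ℕ)) D]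
    push_cast
    field_simp
    ring
  have hterm (j : ∀ i, Fin (D / a i)) (v : Fin (m + 1) → ℕ) :
      (((∑ i, a i * piDivModEquiv _ hM ⟨j, v⟩ i : ℕ) : ℂ) + (w : ℂ)) ^ (-s) =
        1 / (D : ℂ) ^ s * (((∑ i, v i : ℕ) : ℂ) +
          (((∑ i, a i * (j i : ℕ) : ℕ) : ℂ) + w) / D) ^ (-s) := by
    have hsum : ∑ i, a i * piDivModEquiv _ hM ⟨j, v⟩ i =
        ∑ i, a i * (j i : ℕ) + D * ∑ i, v i := by
      rw [Finset.mul_sum, ← Finset.sum_add_distrib]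
      refine Finset.sum_congr rfl fun i _ ↦ ?_
      change a i * (j i + D / a i * v i) = _
      rw [mul_add, ← mul_assoc, Nat.mul_div_cancel' (hdvd i)]
    rw [hsum]
    generalize ∑ i, a i * (j i : ℕ) = S
    generalize ∑ i, v i = n
    have hpos : 0 ≤ (n : ℝ) + (S + w) / D := by positivity
    rw [one_div, ← Complex.cpow_neg]
    have := Complex.mul_cpow_ofReal_nonneg hDR.le hpos (-s)
    push_cast at this ⊢
    rw [← this]
    congr 1
    field_simp
    ring
  refine hasSum_sigma_of_summable_norm (fun j ↦ ?_) (Summable.of_finite) (hasSum_fintype _)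
  have h := (hfiber j).congr_fun (hterm j)
  rw [← mul_assoc, one_div_mul_one_div] at h
  simp only [Complex.ofReal_div, Complex.ofReal_add, Complex.ofReal_natCast] at h
  exact h
end

section
/- Suppose polynomials P_λ ∈ ℂ[X], one for each complex λ with λ^D = 1, satisfy p_a(n) = ∑_{λ: λ^D = 1} P_λ(n) λ^{−n} for all n ≥ 0. Then the polynomial part P_a := P_1 satisfies, as polynomials in n, P_a(n) = (1/(D(r−1)!)) ∑_{(j_1,…,j_r): 0 ≤ j_i ≤ D/a_i − 1 for all i} ∏_{ℓ=1}^{r−1} ( (n − a_1j_1 − ⋯ − a_rj_r)/D + ℓ ). -/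
/-- The restricted partition function: the number of tuples `(x₁,…,x_r)` of nonnegative
integers with `a₁x₁+⋯+a_rx_r = n`. -/
noncomputable def restrictedPartition (r : ℕ) (a : Fin r → ℕ) (n : ℕ) : ℕ :=
  Nat.card {x : Fin r → ℕ // ∑ i, a i * x i = n}

open Polynomial

/-- Dividing each coordinate of a solution of `∑ aᵢ xᵢ = n` by `D / aᵢ` with remainder
identifies it with a tuple of remainders `j` and a tuple of quotients `q` such that
`D ∑ qᵢ + ∑ aᵢ jᵢ = n`. -/
noncomputable def solutionEquivSigma {r : ℕ} {a : Fin r → ℕ} (ha : ∀ i, 0 < a i)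
    {D : ℕ} (hD : 0 < D) (hdvd : ∀ i, a i ∣ D) (n : ℕ) :
    {x : Fin r → ℕ // ∑ i, a i * x i = n} ≃
      Σ j : ∀ i : Fin r, Fin (D / a i),
        {q : Fin r → ℕ // D * ∑ i, q i + ∑ i, a i * (j i : ℕ) = n} :=
  have hpos (i : Fin r) : 0 < D / a i := Nat.div_pos (Nat.le_of_dvd hD (hdvd i)) (ha i)
  let e : {x : Fin r → ℕ // ∑ i, a i * x i = n} ≃
      {p : (∀ i : Fin r, Fin (D / a i)) × (Fin r → ℕ) //
        D * ∑ i, p.2 i + ∑ i, a i * (p.1 i : ℕ) = n} :=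
    { toFun := fun x => ⟨(fun i => ⟨x.1 i % (D / a i), Nat.mod_lt _ (hpos i)⟩,
          fun i => x.1 i / (D / a i)), by
        refine Eq.trans ?_ x.2
        rw [Finset.mul_sum, ← Finset.sum_add_distrib]
        refine Finset.sum_congr rfl fun i _ => ?_
        conv_rhs => rw [← Nat.div_add_mod (x.1 i) (D / a i), mul_add, ← mul_assoc,
          Nat.mul_div_cancel' (hdvd i)]⟩
      invFun := fun p => ⟨fun i => D / a i * p.1.2 i + p.1.1 i, by
        refine Eq.trans ?_ p.2
        rw [Finset.mul_sum, ← Finset.sum_add_distrib]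
        refine Finset.sum_congr rfl fun i _ => ?_
        rw [mul_add, ← mul_assoc, Nat.mul_div_cancel' (hdvd i)]⟩
      left_inv := fun x => Subtype.ext <| funext fun i => Nat.div_add_mod _ _
      right_inv := fun p => by
        refine Subtype.ext (Prod.ext (funext fun i => Fin.ext ?_) (funext fun i => ?_))
        · simp [Nat.mod_eq_of_lt (p.1.1 i).2]
        · simp [Nat.mul_add_div (hpos i), Nat.div_eq_of_lt (p.1.1 i).2] }
  e.trans (Equiv.subtypeProdEquivSigmaSubtype
    fun (j : ∀ i : Fin r, Fin (D / a i)) (q : Fin r → ℕ) =>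
      D * ∑ i, q i + ∑ i, a i * (j i : ℕ) = n)

lemma finite_sum_eq (r m : ℕ) : Finite {q : Fin r → ℕ // ∑ i, q i = m} :=
  Finite.of_equiv _ (Sym.equivNatSumOfFintype (Fin r) m)

lemma natCard_sum_eq {r : ℕ} (hr : 1 ≤ r) (m : ℕ) :
    Nat.card {q : Fin r → ℕ // ∑ i, q i = m} = (m + (r - 1)).choose (r - 1) := by
  rw [← Nat.card_congr (Sym.equivNatSumOfFintype (Fin r) m), Nat.card_eq_fintype_card,
    Sym.card_sym_eq_choose, Fintype.card_fin, ← Nat.choose_symm_add]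
  congr 1
  omega

lemma finite_mul_sum_add_eq {D : ℕ} (hD : 0 < D) (r A n : ℕ) :
    Finite {q : Fin r → ℕ // D * ∑ i, q i + A = n} := by
  have := finite_sum_eq r ((n - A) / D)
  refine Finite.of_injective
    (fun q : {q : Fin r → ℕ // D * ∑ i, q i + A = n} =>
      (⟨q.1, ?_⟩ : {q : Fin r → ℕ // ∑ i, q i = (n - A) / D})) fun q q' h => ?_
  · rw [← Nat.eq_sub_of_add_eq q.2, Nat.mul_div_cancel_left _ hD]
  · exact Subtype.ext (congrArg (fun x => x.1) h)

lemma natCard_mul_sum_add_eq {r : ℕ} (hr : 1 ≤ r) {D : ℕ} (hD : 0 < D) {A n : ℕ} (hA : A ≤ n) :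
    (Nat.card {q : Fin r → ℕ // D * ∑ i, q i + A = n} : ℂ) =
      if A % D = n % D then
        1 / ((r - 1).factorial : ℂ) *
          ∏ l ∈ Finset.range (r - 1), (1 / (D : ℂ) * ((n : ℂ) - A) + ((l : ℂ) + 1))
      else 0 := by
  split_ifs with h
  · obtain ⟨m, hm⟩ := (Nat.modEq_iff_dvd' hA).1 h
    obtain rfl : n = D * m + A := by omega
    have hcard : Nat.card {q : Fin r → ℕ // D * ∑ i, q i + A = D * m + A} =
        Nat.card {q : Fin r → ℕ // ∑ i, q i = m} :=
      Nat.card_congr <| Equiv.subtypeEquivRight fun q => by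
        rw [Nat.add_right_cancel_iff, Nat.mul_right_inj hD.ne']
    have hDC : (D : ℂ) ≠ 0 := Nat.cast_ne_zero.2 hD.ne'
    have hprod : ∏ l ∈ Finset.range (r - 1),
        (1 / (D : ℂ) * (((D * m + A : ℕ) : ℂ) - A) + ((l : ℂ) + 1)) =
        ((m + 1).ascFactorial (r - 1) : ℂ) := by
      rw [Nat.ascFactorial_eq_prod_range, Nat.cast_prod]
      refine Finset.prod_congr rfl fun l _ => ?_
      push_cast
      field_simp
      ring
    rw [hcard, natCard_sum_eq hr, hprod, Nat.ascFactorial_eq_factorial_mul_choose]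
    have := Nat.cast_ne_zero (R := ℂ).2 (r - 1).factorial_ne_zero
    push_cast
    field_simp
  · have : IsEmpty {q : Fin r → ℕ // D * ∑ i, q i + A = n} :=
      ⟨fun q => h (by rw [← q.2, Nat.mul_add_mod])⟩
    simp

/-- The formula holds for all `n` at least `∑ aᵢ (D / aᵢ) = r D`, where every
`∑ aᵢ jᵢ` is at most `n`. -/
lemma restrictedPartition_eq_sum {r : ℕ} (hr : 1 ≤ r) {a : Fin r → ℕ} (ha : ∀ i, 0 < a i)
    {D : ℕ} (hD : 0 < D) (hdvd : ∀ i, a i ∣ D) {n : ℕ} (hn : r * D ≤ n) :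
    (restrictedPartition r a n : ℂ) =
      ∑ j : ∀ i : Fin r, Fin (D / a i),
        if (∑ i, a i * (j i : ℕ)) % D = n % D then
          1 / ((r - 1).factorial : ℂ) * ∏ l ∈ Finset.range (r - 1),
            (1 / (D : ℂ) * ((n : ℂ) - (∑ i, a i * (j i : ℕ) : ℕ)) + ((l : ℂ) + 1))
        else 0 := by
  have hfin (j : ∀ i : Fin r, Fin (D / a i)) :=
    finite_mul_sum_add_eq hD r (∑ i, a i * (j i : ℕ)) n
  rw [restrictedPartition, Nat.card_congr (solutionEquivSigma ha hD hdvd n), Nat.card_sigma,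
    Nat.cast_sum]
  refine Finset.sum_congr rfl fun j _ => natCard_mul_sum_add_eq hr hD (le_trans ?_ hn)
  calc ∑ i, a i * (j i : ℕ) ≤ ∑ _i : Fin r, D := Finset.sum_le_sum fun i _ => by
        calc a i * (j i : ℕ) ≤ a i * (D / a i) := Nat.mul_le_mul_left _ (j i).2.le
          _ = D := Nat.mul_div_cancel' (hdvd i)
    _ = r * D := by simp

lemma sum_range_zpow_neg_of_pow_eq_one {D : ℕ} {z : ℂ} (hz : z ^ D = 1) :
    ∑ s ∈ Finset.range D, z ^ (-(s : ℤ)) = if z = 1 then (D : ℂ) else 0 := by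
  split_ifs with h
  · simp [h]
  · simp only [zpow_neg, zpow_natCast, ← inv_pow]
    rw [geom_sum_eq (by simpa using h), inv_pow, hz]
    simp

/-- Polynomials that agree at all large natural numbers of a fixed residue class modulo `D` are
equal. -/
lemma Polynomial.eq_of_eval_eq_on_residue_class {p q : ℂ[X]} {D s N : ℕ} (hD : 0 < D)
    (h : ∀ k : ℕ, N ≤ k → p.eval ((s + D * k : ℕ) : ℂ) = q.eval ((s + D * k : ℕ) : ℂ)) :
    p = q := by
  refine Polynomial.eq_of_infinite_eval_eq p q (Set.Infinite.mono ?_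
    (Set.infinite_range_of_injective (f := fun k : ℕ => ((s + D * (N + k) : ℕ) : ℂ)) ?_))
  · rintro _ ⟨k, rfl⟩
    exact h _ (Nat.le_add_right _ _)
  · intro k k' hk
    simpa [hD.ne'] using hk


/-- Corollary 2.6: the polynomial part `P_a = P_1` of the quasi-polynomial `p_a`
satisfies `P_a(n) = (1/(D(r−1)!)) ∑_j ∏_{ℓ=1}^{r−1} ((n − a·j)/D + ℓ)`, the sum being
over all tuples `j` with `0 ≤ jᵢ ≤ D/aᵢ − 1`. -/
theorem polynomial_part_product_formula
    (r : ℕ) (hr : 1 ≤ r) (a : Fin r → ℕ) (ha : ∀ i, 0 < a i)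
    (D : ℕ) (hD : 0 < D) (hdvd : ∀ i, a i ∣ D)
    (P : ℂ → Polynomial ℂ)
    (hP : ∀ n : ℕ, (restrictedPartition r a n : ℂ) =
      ∑ l ∈ (Polynomial.nthRoots D (1 : ℂ)).toFinset, (P l).eval (n : ℂ) * l ^ (-(n : ℤ))) :
    P 1 = Polynomial.C (1 / ((D : ℂ) * (Nat.factorial (r - 1) : ℂ))) *
      ∑ j : ∀ i : Fin r, Fin (D / a i),
        ∏ l ∈ Finset.range (r - 1),
          (Polynomial.C (1 / (D : ℂ)) *
              (Polynomial.X - Polynomial.C ((∑ i, a i * (j i : ℕ) : ℕ) : ℂ)) +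
            Polynomial.C ((l : ℂ) + 1)) := by
  have hDC : (D : ℂ) ≠ 0 := Nat.cast_ne_zero.2 hD.ne'
  have hmem {z : ℂ} : z ∈ (nthRoots D (1 : ℂ)).toFinset ↔ z ^ D = 1 := by
    rw [Multiset.mem_toFinset, mem_nthRoots hD]
  set Q : (∀ i : Fin r, Fin (D / a i)) → ℂ[X] := fun j =>
    ∏ l ∈ Finset.range (r - 1),
      (C (1 / (D : ℂ)) * (X - C ((∑ i, a i * (j i : ℕ) : ℕ) : ℂ)) + C ((l : ℂ) + 1)) with hQ
  have hclass (s : ℕ) (hs : s ∈ Finset.range D) :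
      ∑ z ∈ (nthRoots D (1 : ℂ)).toFinset, P z * C (z ^ (-(s : ℤ))) =
        ∑ j, if (∑ i, a i * (j i : ℕ)) % D = s then
          C (1 / ((r - 1).factorial : ℂ)) * Q j else 0 := by
    refine eq_of_eval_eq_on_residue_class (s := s) (N := r) hD fun k hk => ?_
    have hmod : (s + D * k) % D = s := by
      rw [Nat.add_mul_mod_self_left, Nat.mod_eq_of_lt (Finset.mem_range.1 hs)]
    have hle : r * D ≤ s + D * k := by
      calc r * D ≤ k * D := Nat.mul_le_mul_right _ hk
        _ = D * k := mul_comm _ _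
        _ ≤ s + D * k := Nat.le_add_left _ _
    have hcount := (hP (s + D * k)).symm.trans (restrictedPartition_eq_sum hr ha hD hdvd hle)
    rw [hmod] at hcount
    rw [eval_finsetSum, eval_finsetSum]
    convert hcount using 2 with z hz j
    · rw [eval_mul, eval_C]
      congr 1
      rw [zpow_neg, zpow_neg, zpow_natCast, zpow_natCast, pow_add, pow_mul, hmem.1 hz, one_pow,
        mul_one]
    · split_ifs
      · simp only [hQ, eval_mul, eval_C, eval_prod, eval_add, eval_sub, eval_X]
      · simp
  have hsum := Finset.sum_congr (rfl : Finset.range D = Finset.range D) hclass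
  rw [Finset.sum_comm, Finset.sum_comm (s := Finset.range D)] at hsum
  have hleft : ∑ z ∈ (nthRoots D (1 : ℂ)).toFinset,
      ∑ s ∈ Finset.range D, P z * C (z ^ (-(s : ℤ))) = P 1 * C (D : ℂ) := by
    rw [Finset.sum_eq_single_of_mem 1 (hmem.2 (one_pow D))]
    · rw [← Finset.mul_sum, ← map_sum, sum_range_zpow_neg_of_pow_eq_one (one_pow D), if_pos rfl]
    · intro z hz hz1
      rw [← Finset.mul_sum, ← map_sum, sum_range_zpow_neg_of_pow_eq_one (hmem.1 hz),
        if_neg hz1, C_0, mul_zero]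
  simp only [Finset.sum_ite_eq, Finset.mem_range, Nat.mod_lt _ hD, if_true] at hsum
  rw [hleft, ← Finset.mul_sum] at hsum
  calc P 1 = C (1 / (D : ℂ)) * (P 1 * C (D : ℂ)) := by
        rw [mul_left_comm, ← C_mul, one_div_mul_cancel hDC, C_1, mul_one]
    _ = _ := by rw [hsum, ← mul_assoc, ← C_mul, one_div_mul_one_div]
end
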